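/- Let m ≥ 2 and n ≥ 3. Define H_0(y) = y, H_j(y) = ln(H_{j−1}(y)), and φ(t) = ln( 2(n−2) · H_m'(2t) ) for t large. Then, as t → ∞: (i) φ(t)/ln t → −1; (ii) φ'(t) = −1/t + O( 1/(t·ln t) ); (iii) φ''(t) = O(1/t²). Moreover there exists c_m > 0 such that 1/(c_m · t · (ln t)²) ≤ H_m'(2t + φ(t)) ≤ c_m/(t · ln t) for all t large. -/

import Mathlib

/-- The iterated logarithm: `H₀(y) = y`, `H_{j+1}(y) = ln(H_j(y))`. -/
noncomputable def iterLog : ℕ → ℝ → ℝ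
  | 0 => fun y => y
  | (j + 1) => fun y => Real.log (iterLog j y)

/-- `φ(t) = ln(2(n-2) H_m'(2t))`. -/
noncomputable def phiIter (m n : ℕ) (t : ℝ) : ℝ :=
  Real.log (2 * ((n : ℝ) - 2) * deriv (iterLog m) (2 * t))

open Filter Topology Asymptotics

theorem iterLog_succ (j : ℕ) (y : ℝ) : iterLog (j + 1) y = Real.log (iterLog j y) := rfl

theorem iterLog_one (y : ℝ) : iterLog 1 y = Real.log y := rfl

theorem iterLog_succ_eq_iterLog_log (j : ℕ) (y : ℝ) :
    iterLog (j + 1) y = iterLog j (Real.log y) := by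
  induction j with
  | zero => rfl
  | succ k ih => rw [iterLog_succ, ih, iterLog_succ]

theorem tendsto_iterLog_atTop (j : ℕ) : Tendsto (iterLog j) atTop atTop := by
  induction j with
  | zero => exact tendsto_id
  | succ k ih => exact Real.tendsto_log_atTop.comp ih

/-- The product `∏_{j<k} H_j(y)`, the reciprocal of `H_k'(y)` for large `y`. -/
noncomputable def iterLogProd (k : ℕ) (y : ℝ) : ℝ := ∏ j ∈ Finset.range k, iterLog j y

theorem iterLogProd_succ (k : ℕ) (y : ℝ) :
    iterLogProd (k + 1) y = iterLogProd k y * iterLog k y :=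
  Finset.prod_range_succ _ _

theorem iterLogProd_succ' (k : ℕ) (y : ℝ) :
    iterLogProd (k + 1) y = iterLogProd k (Real.log y) * y := by
  simp only [iterLogProd, Finset.prod_range_succ', iterLog_succ_eq_iterLog_log]
  rfl

theorem eventually_one_lt_iterLog (m : ℕ) :
    ∀ᶠ y in atTop, ∀ j < m, 1 < iterLog j y := by
  have h : ∀ᶠ y in atTop, ∀ j ∈ Finset.range m, 1 < iterLog j y :=
    (Finset.eventually_all _).2 fun j _ => (tendsto_iterLog_atTop j).eventually_gt_atTop 1
  simpa using h

theorem one_le_iterLogProd {k : ℕ} {y : ℝ} (h : ∀ j < k, 1 < iterLog j y) :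
    1 ≤ iterLogProd k y := by
  induction k with
  | zero => simp [iterLogProd]
  | succ k ih =>
    rw [iterLogProd_succ]
    exact one_le_mul_of_one_le_of_one_le (ih fun j hj => h j (by omega)) (h k (by omega)).le

theorem iterLogProd_le_of_le {k l : ℕ} {y : ℝ} (hkl : k ≤ l) (h : ∀ j < l, 1 < iterLog j y) :
    iterLogProd k y ≤ iterLogProd l y := by
  induction l, hkl using Nat.le_induction with
  | base => exact le_rfl
  | succ l hkl ih =>
    have h' : ∀ j < l, 1 < iterLog j y := fun j hj => h j (by omega)
    rw [iterLogProd_succ]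
    exact (ih h').trans
      (le_mul_of_one_le_right (by linarith [one_le_iterLogProd h']) (h l (by omega)).le)

theorem hasDerivAt_iterLog {k : ℕ} {y : ℝ} (h : ∀ j < k, 1 < iterLog j y) :
    HasDerivAt (iterLog k) (iterLogProd k y)⁻¹ y := by
  induction k with
  | zero =>
    have : HasDerivAt (iterLog 0) 1 y := hasDerivAt_id y
    simpa [iterLogProd] using this
  | succ k ih =>
    have hk := h k (by omega)
    have := (ih fun j hj => h j (by omega)).log (by linarith)
    rw [iterLogProd_succ, mul_inv, ← div_eq_mul_inv]
    exact this

theorem hasDerivAt_inv_iterLogProd {k : ℕ} {y : ℝ} (h : ∀ j < k, 1 < iterLog j y) :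
    HasDerivAt (fun y => (iterLogProd k y)⁻¹)
      (-((iterLogProd k y)⁻¹ * ∑ i ∈ Finset.range k, (iterLogProd (i + 1) y)⁻¹)) y := by
  induction k with
  | zero => simpa [iterLogProd] using hasDerivAt_const y (1 : ℝ)
  | succ k ih =>
    have h' : ∀ j < k, 1 < iterLog j y := fun j hj => h j (by omega)
    have hk := h k (by omega)
    have hk0 : iterLog k y ≠ 0 := by linarith
    have hP : iterLogProd k y ≠ 0 := by linarith [one_le_iterLogProd h']
    have := (ih h').mul ((hasDerivAt_iterLog h').inv hk0)
    have heq : (fun y => (iterLogProd (k + 1) y)⁻¹) =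
        (fun y => (iterLogProd k y)⁻¹) * (iterLog k)⁻¹ := by
      ext y
      rw [iterLogProd_succ, mul_inv]
      rfl
    rw [heq]
    refine this.congr_deriv ?_
    rw [Finset.sum_range_succ, iterLogProd_succ, Pi.inv_apply]
    field_simp
    ring

/-- The sum `∑_{j<m} H_{j+1}(y)`, which is `-ln H_m'(y)` for large `y`. -/
noncomputable def iterLogSum (m : ℕ) (y : ℝ) : ℝ := ∑ j ∈ Finset.range m, iterLog (j + 1) y

theorem log_iterLogProd {m : ℕ} {y : ℝ} (h : ∀ j < m, 1 < iterLog j y) :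
    Real.log (iterLogProd m y) = iterLogSum m y :=
  Real.log_prod fun j hj => by linarith [h j (Finset.mem_range.1 hj)]

theorem phiIter_eq {m n : ℕ} (hn : 3 ≤ n) {t : ℝ} (h : ∀ j < m, 1 < iterLog j (2 * t)) :
    phiIter m n t = Real.log (2 * ((n : ℝ) - 2)) - iterLogSum m (2 * t) := by
  have hn' : (3 : ℝ) ≤ n := by exact_mod_cast hn
  have hP := one_le_iterLogProd h
  rw [phiIter, (hasDerivAt_iterLog h).deriv, Real.log_mul (by linarith)
    (inv_ne_zero (by linarith)), Real.log_inv, log_iterLogProd h, ← sub_eq_add_neg]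

theorem hasDerivAt_iterLogSum {m : ℕ} {y : ℝ} (h : ∀ j < m, 1 < iterLog j y) :
    HasDerivAt (iterLogSum m) (∑ j ∈ Finset.range m, (iterLogProd (j + 1) y)⁻¹) y :=
  HasDerivAt.fun_sum fun j hj => hasDerivAt_iterLog fun i hi =>
    h i (by have := Finset.mem_range.1 hj; omega)

theorem eventually_eventually_nhds_of_atTop {p : ℝ → Prop} (h : ∀ᶠ t in atTop, p t) :
    ∀ᶠ t in atTop, ∀ᶠ s in 𝓝 t, p s := by
  obtain ⟨a, ha⟩ := eventually_atTop.1 h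
  filter_upwards [eventually_gt_atTop a] with t ht
  filter_upwards [Ioi_mem_nhds ht] with s hs using ha s (le_of_lt hs)

theorem eventually_one_lt_iterLog_two_mul (m : ℕ) :
    ∀ᶠ t : ℝ in atTop, ∀ j < m, 1 < iterLog j (2 * t) :=
  (tendsto_id.const_mul_atTop two_pos).eventually (eventually_one_lt_iterLog m)

theorem eventually_deriv_phiIter (m : ℕ) {n : ℕ} (hn : 3 ≤ n) :
    ∀ᶠ t in atTop, deriv (phiIter m n) t =
      -(2 * ∑ j ∈ Finset.range m, (iterLogProd (j + 1) (2 * t))⁻¹) := by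
  filter_upwards [eventually_eventually_nhds_of_atTop (eventually_one_lt_iterLog_two_mul m)]
    with t ht
  have heq : phiIter m n =ᶠ[𝓝 t]
      fun t => Real.log (2 * ((n : ℝ) - 2)) - iterLogSum m (2 * t) := by
    filter_upwards [ht] with s hs using phiIter_eq hn hs
  have hd : HasDerivAt (fun t : ℝ => 2 * t) 2 t := by
    simpa using (hasDerivAt_id t).const_mul 2
  have := ((hasDerivAt_iterLogSum ht.self_of_nhds).comp t hd).const_sub
    (Real.log (2 * ((n : ℝ) - 2)))
  rw [heq.deriv_eq, mul_comm (2 : ℝ) (∑ _ ∈ _, _)]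
  exact this.deriv

theorem eventually_deriv_deriv_phiIter (m : ℕ) {n : ℕ} (hn : 3 ≤ n) :
    ∀ᶠ t in atTop, deriv (deriv (phiIter m n)) t =
      4 * ∑ j ∈ Finset.range m, (iterLogProd (j + 1) (2 * t))⁻¹ *
        ∑ i ∈ Finset.range (j + 1), (iterLogProd (i + 1) (2 * t))⁻¹ := by
  filter_upwards [eventually_eventually_nhds_of_atTop (eventually_deriv_phiIter m hn),
    eventually_one_lt_iterLog_two_mul m] with t heq ht
  have hd : HasDerivAt (fun t : ℝ => 2 * t) 2 t := by
    simpa using (hasDerivAt_id t).const_mul 2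
  have hsum : HasDerivAt (fun t : ℝ => ∑ j ∈ Finset.range m, (iterLogProd (j + 1) (2 * t))⁻¹)
      (∑ j ∈ Finset.range m, -((iterLogProd (j + 1) (2 * t))⁻¹ *
        ∑ i ∈ Finset.range (j + 1), (iterLogProd (i + 1) (2 * t))⁻¹) * 2) t :=
    HasDerivAt.fun_sum fun j hj => HasDerivAt.comp t
      (h₂ := fun y => (iterLogProd (j + 1) y)⁻¹) (hasDerivAt_inv_iterLogProd (k := j + 1) fun i hi =>
        ht i (by have := Finset.mem_range.1 hj; omega)) hd
  rw [EventuallyEq.deriv_eq heq, (hsum.const_mul 2).fun_neg.deriv, ← Finset.sum_mul,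
    Finset.sum_neg_distrib]
  ring

theorem inv_iterLogProd_succ_le {m j : ℕ} {y : ℝ} (h : ∀ j < m, 1 < iterLog j y) (hj : j < m) :
    0 ≤ (iterLogProd (j + 1) y)⁻¹ ∧ (iterLogProd (j + 1) y)⁻¹ ≤ y⁻¹ := by
  have h0 : 1 < y := h 0 (by omega)
  have h1 : ∀ i < j + 1, 1 < iterLog i y := fun i hi => h i (by omega)
  have hle := iterLogProd_le_of_le (k := 1) (l := j + 1) (by omega) h1
  have hy : iterLogProd 1 y = y := by simp [iterLogProd, iterLog]
  rw [hy] at hle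
  exact ⟨inv_nonneg.2 (by linarith), inv_anti₀ (by linarith) hle⟩

theorem inv_iterLogProd_le {m : ℕ} {y : ℝ} (hm : 2 ≤ m) (h : ∀ j < m, 1 < iterLog j y) :
    0 ≤ (iterLogProd m y)⁻¹ ∧ (iterLogProd m y)⁻¹ ≤ (y * Real.log y)⁻¹ := by
  have h0 : 1 < y := h 0 (by omega)
  have h1 : 1 < Real.log y := h 1 (by omega)
  have hle := iterLogProd_le_of_le hm h
  have hy : iterLogProd 2 y = y * Real.log y := by
    simp [iterLogProd, Finset.prod_range_succ, iterLog]
  rw [hy] at hle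
  have : 0 < y * Real.log y := by positivity
  exact ⟨inv_nonneg.2 (by linarith), inv_anti₀ this hle⟩

theorem iterLog_add_two_isLittleO_log (k : ℕ) :
    (fun y => iterLog (k + 2) y) =o[atTop] Real.log := by
  induction k with
  | zero => exact Real.isLittleO_log_id_atTop.comp_tendsto Real.tendsto_log_atTop
  | succ k ih =>
    exact (Real.isLittleO_log_id_atTop.comp_tendsto (tendsto_iterLog_atTop (k + 2))).trans ih

theorem tendsto_iterLogSum_div_log (m : ℕ) :
    Tendsto (fun y => iterLogSum (m + 1) y / Real.log y) atTop (𝓝 1) := by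
  have h : (fun y => ∑ j ∈ Finset.range m, iterLog (j + 2) y) =o[atTop] Real.log :=
    IsLittleO.fun_sum fun j _ => iterLog_add_two_isLittleO_log j
  have := h.tendsto_div_nhds_zero.add_const 1
  rw [zero_add] at this
  refine this.congr' ?_
  filter_upwards [Real.tendsto_log_atTop.eventually_gt_atTop 0] with y hy
  rw [iterLogSum, Finset.sum_range_succ', zero_add, iterLog_one, add_div, div_self hy.ne']

theorem tendsto_log_two_mul_div_log :
    Tendsto (fun t : ℝ => Real.log (2 * t) / Real.log t) atTop (𝓝 1) := by
  have := (Real.tendsto_log_atTop.const_div_atTop (Real.log 2)).add_const 1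
  rw [zero_add] at this
  refine this.congr' ?_
  filter_upwards [Real.tendsto_log_atTop.eventually_gt_atTop 0, eventually_gt_atTop 0]
    with t hy ht
  rw [Real.log_mul two_ne_zero ht.ne', add_div, div_self hy.ne']

theorem tendsto_phiIter_div_log {m n : ℕ} (hm : 1 ≤ m) (hn : 3 ≤ n) :
    Tendsto (fun t : ℝ => phiIter m n t / Real.log t) atTop (𝓝 (-1)) := by
  obtain ⟨k, rfl⟩ := Nat.exists_eq_add_of_le' hm
  have h2 : Tendsto (fun t : ℝ => 2 * t) atTop atTop := tendsto_id.const_mul_atTop two_pos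
  have := (Real.tendsto_log_atTop.const_div_atTop (Real.log (2 * ((n : ℝ) - 2)))).sub
    (((tendsto_iterLogSum_div_log k).comp h2).mul tendsto_log_two_mul_div_log)
  rw [mul_one, zero_sub] at this
  refine this.congr' ?_
  filter_upwards [eventually_one_lt_iterLog_two_mul (k + 1),
    (Real.tendsto_log_atTop.comp h2).eventually_gt_atTop 0] with t ht hl
  have hl' : Real.log (2 * t) ≠ 0 := hl.ne'
  rw [phiIter_eq hn ht, sub_div, Function.comp_apply, div_mul_div_cancel₀ hl']

theorem iterLogProd_log_isBigO (k : ℕ) :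
    (fun y => iterLogProd k (Real.log y)) =O[atTop] fun y => y := by
  induction k with
  | zero =>
    simp only [iterLogProd, Finset.range_zero, Finset.prod_empty]
    exact (isLittleO_const_id_atTop (1 : ℝ)).isBigO
  | succ k ih =>
    simp only [iterLogProd_succ']
    have h1 := (ih.comp_tendsto Real.tendsto_log_atTop).mul
      (isBigO_refl Real.log atTop)
    have h2 := (Real.isLittleO_pow_log_id_atTop (n := 2)).isBigO
    simp only [pow_two] at h2
    exact h1.trans h2

theorem iterLogProd_add_two_isBigO (k : ℕ) :
    iterLogProd (k + 2) =O[atTop] fun y => y * Real.log y ^ 2 := by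
  have h := (((iterLogProd_log_isBigO k).comp_tendsto Real.tendsto_log_atTop).mul
    (isBigO_refl Real.log atTop)).mul (isBigO_refl (fun y : ℝ => y) atTop)
  refine h.congr (fun y => ?_) fun y => ?_
  · rw [iterLogProd_succ', iterLogProd_succ']
    rfl
  · simp only [Function.comp_apply]
    ring

theorem eventually_two_mul_add_phiIter {m n : ℕ} (hm : 1 ≤ m) (hn : 3 ≤ n) :
    ∀ᶠ t in atTop, t ≤ 2 * t + phiIter m n t ∧ 2 * t + phiIter m n t ≤ 2 * t := by
  have h := tendsto_phiIter_div_log hm hn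
  have hlog := Real.isLittleO_log_id_atTop.bound (show (0 : ℝ) < 1 / 2 by norm_num)
  filter_upwards [h.eventually_lt_const (show (-1 : ℝ) < 0 by norm_num),
    h.eventually_const_lt (show (-2 : ℝ) < -1 by norm_num), hlog,
    Real.tendsto_log_atTop.eventually_gt_atTop 0, eventually_gt_atTop 0] with t h1 h2 h3 hl ht
  rw [div_lt_iff₀ hl] at h1
  rw [lt_div_iff₀ hl] at h2
  simp only [id, Real.norm_eq_abs, abs_of_pos hl, abs_of_pos ht] at h3
  constructor <;> linarith

theorem exists_pos_of_eventually_atTop {p : ℝ → Prop} (h : ∀ᶠ t in atTop, p t) :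
    ∃ T > (0 : ℝ), ∀ t > T, p t := by
  obtain ⟨a, ha⟩ := eventually_atTop.1 h
  exact ⟨max a 1, by positivity, fun t ht => ha t ((le_max_left _ _).trans ht.le)⟩

theorem eventually_abs_deriv_phiIter_le {m n : ℕ} (hn : 3 ≤ n) :
    ∀ᶠ t in atTop, |deriv (phiIter (m + 1) n) t + 1 / t| ≤ (m + 1) / (t * Real.log t) := by
  filter_upwards [eventually_deriv_phiIter (m + 1) hn, eventually_one_lt_iterLog_two_mul (m + 1),
    eventually_gt_atTop 1] with t hd ht ht1
  have ht0 : 0 < t := by linarith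
  have hl : 0 < Real.log t := Real.log_pos ht1
  have hl2 : Real.log t ≤ Real.log (2 * t) := Real.log_le_log ht0 (by linarith)
  have hb : ∀ j ∈ Finset.range m, 0 ≤ (iterLogProd (j + 2) (2 * t))⁻¹ ∧
      (iterLogProd (j + 2) (2 * t))⁻¹ ≤ (2 * t * Real.log t)⁻¹ := fun j hj => by
    have := inv_iterLogProd_le (m := j + 2) (y := 2 * t) (by omega)
      fun i hi => ht i (by have := Finset.mem_range.1 hj; omega)
    exact ⟨this.1, this.2.trans (inv_anti₀ (by positivity) (by gcongr))⟩
  have hs0 := Finset.sum_nonneg fun j hj => (hb j hj).1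
  have hs1 := Finset.sum_le_sum fun j hj => (hb j hj).2
  have heq : deriv (phiIter (m + 1) n) t + 1 / t =
      -(2 * ∑ j ∈ Finset.range m, (iterLogProd (j + 2) (2 * t))⁻¹) := by
    have h1 : iterLogProd 1 (2 * t) = 2 * t := by simp [iterLogProd, iterLog]
    rw [hd, Finset.sum_range_succ', zero_add, h1]
    field_simp
    ring
  rw [heq, abs_neg, abs_of_nonneg (by positivity)]
  rw [Finset.sum_const, Finset.card_range, nsmul_eq_mul] at hs1
  calc _ ≤ 2 * (m * (2 * t * Real.log t)⁻¹) := by gcongr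
    _ = m / (t * Real.log t) := by field_simp
    _ ≤ _ := by gcongr; linarith

theorem eventually_abs_deriv_deriv_phiIter_le (m : ℕ) {n : ℕ} (hn : 3 ≤ n) :
    ∀ᶠ t in atTop, |deriv (deriv (phiIter m n)) t| ≤ m ^ 2 / t ^ 2 := by
  filter_upwards [eventually_deriv_deriv_phiIter m hn, eventually_one_lt_iterLog_two_mul m,
    eventually_gt_atTop 0] with t hd ht ht0
  have hin : ∀ j ∈ Finset.range m,
      0 ≤ ∑ i ∈ Finset.range (j + 1), (iterLogProd (i + 1) (2 * t))⁻¹ ∧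
      ∑ i ∈ Finset.range (j + 1), (iterLogProd (i + 1) (2 * t))⁻¹ ≤ m * (2 * t)⁻¹ := by
    intro j hj
    have hj' := Finset.mem_range.1 hj
    have hb : ∀ i ∈ Finset.range (j + 1), 0 ≤ (iterLogProd (i + 1) (2 * t))⁻¹ ∧
        (iterLogProd (i + 1) (2 * t))⁻¹ ≤ (2 * t)⁻¹ := fun i hi =>
      inv_iterLogProd_succ_le ht (by have := Finset.mem_range.1 hi; omega)
    refine ⟨Finset.sum_nonneg fun i hi => (hb i hi).1,
      (Finset.sum_le_sum fun i hi => (hb i hi).2).trans ?_⟩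
    rw [Finset.sum_const, Finset.card_range, nsmul_eq_mul]
    gcongr
    omega
  have hb : ∀ j ∈ Finset.range m, 0 ≤ (iterLogProd (j + 1) (2 * t))⁻¹ *
        ∑ i ∈ Finset.range (j + 1), (iterLogProd (i + 1) (2 * t))⁻¹ ∧
      (iterLogProd (j + 1) (2 * t))⁻¹ *
        ∑ i ∈ Finset.range (j + 1), (iterLogProd (i + 1) (2 * t))⁻¹ ≤
          (2 * t)⁻¹ * (m * (2 * t)⁻¹) := fun j hj => by
    have h1 := inv_iterLogProd_succ_le ht (Finset.mem_range.1 hj)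
    exact ⟨mul_nonneg h1.1 (hin j hj).1,
      mul_le_mul h1.2 (hin j hj).2 (hin j hj).1 (by positivity)⟩
  have hs0 := Finset.sum_nonneg fun j hj => (hb j hj).1
  have hs1 := Finset.sum_le_sum fun j hj => (hb j hj).2
  rw [Finset.sum_const, Finset.card_range, nsmul_eq_mul] at hs1
  rw [hd, abs_of_nonneg (by positivity)]
  calc _ ≤ 4 * (m * ((2 * t)⁻¹ * (m * (2 * t)⁻¹))) := by gcongr
    _ = _ := by field_simp; ring

theorem exists_deriv_iterLog_two_mul_add_phiIter_bounds {m n : ℕ} (hm : 2 ≤ m) (hn : 3 ≤ n) :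
    ∃ c > (0 : ℝ), ∀ᶠ t in atTop,
      1 / (c * t * (Real.log t) ^ 2) ≤ deriv (iterLog m) (2 * t + phiIter m n t) ∧
      deriv (iterLog m) (2 * t + phiIter m n t) ≤ c / (t * Real.log t) := by
  obtain ⟨k, rfl⟩ := Nat.exists_eq_add_of_le' hm
  obtain ⟨C, hC, hbound⟩ := (iterLogProd_add_two_isBigO k).exists_pos
  have hphi := eventually_two_mul_add_phiIter (m := k + 2) (by omega) hn
  have htop : Tendsto (fun t => 2 * t + phiIter (k + 2) n t) atTop atTop :=
    tendsto_atTop_mono' _ (hphi.mono fun t h => h.1) tendsto_id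
  refine ⟨8 * C + 1, by positivity, ?_⟩
  filter_upwards [hphi, htop.eventually hbound.bound,
    htop.eventually (eventually_one_lt_iterLog (k + 2)), eventually_ge_atTop 2]
    with t ⟨hy1, hy2⟩ hP hy ht
  rw [(hasDerivAt_iterLog hy).deriv]
  set y := 2 * t + phiIter (k + 2) n t
  have ht0 : 0 < t := by linarith
  have hl : 0 < Real.log t := Real.log_pos (by linarith)
  have hly1 : Real.log t ≤ Real.log y := Real.log_le_log ht0 hy1
  have hly2 : Real.log y ≤ 2 * Real.log t := by
    have h1 : Real.log y ≤ Real.log (2 * t) := Real.log_le_log (by linarith) hy2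
    have h2 : Real.log 2 ≤ Real.log t := Real.log_le_log two_pos ht
    rw [Real.log_mul two_ne_zero ht0.ne'] at h1
    linarith
  have hly0 : 0 < Real.log y := by linarith
  have hy0 : 0 < y := by linarith
  have hP1 := one_le_iterLogProd hy
  constructor
  · rw [Real.norm_of_nonneg (by linarith), Real.norm_of_nonneg (by positivity)] at hP
    rw [one_div]
    refine inv_anti₀ (by linarith) ?_
    calc _ ≤ C * (y * Real.log y ^ 2) := hP
      _ ≤ C * (2 * t * (2 * Real.log t) ^ 2) := by gcongr
      _ = 8 * C * t * Real.log t ^ 2 := by ring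
      _ ≤ _ := by gcongr; linarith
  · calc _ ≤ (y * Real.log y)⁻¹ := (inv_iterLogProd_le hm hy).2
      _ ≤ (t * Real.log t)⁻¹ := inv_anti₀ (by positivity) (by gcongr)
      _ = 1 / (t * Real.log t) := (one_div _).symm
      _ ≤ _ := by gcongr; linarith

/-- Lemma 4.1(b) and estimate (4.14): for `m ≥ 2`, `n ≥ 3` and
`φ(t) = ln(2(n-2) H_m'(2t))`, as `t → ∞`: `φ(t)/ln t → -1`,
`φ'(t) = -1/t + O(1/(t ln t))`, `φ''(t) = O(1/t²)`, and there is `c_m > 0` with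
`1/(c_m t (ln t)²) ≤ H_m'(2t + φ(t)) ≤ c_m/(t ln t)` for all `t` large. -/
theorem phiIter_estimates (m n : ℕ) (hm : 2 ≤ m) (hn : 3 ≤ n) :
    (Filter.Tendsto (fun t : ℝ => phiIter m n t / Real.log t)
      Filter.atTop (nhds (-1))) ∧
    (∃ C > (0 : ℝ), ∃ T > (0 : ℝ), ∀ t > T,
      |deriv (phiIter m n) t + 1 / t| ≤ C / (t * Real.log t)) ∧
    (∃ C > (0 : ℝ), ∃ T > (0 : ℝ), ∀ t > T,
      |deriv (deriv (phiIter m n)) t| ≤ C / t ^ 2) ∧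
    (∃ c > (0 : ℝ), ∃ T > (0 : ℝ), ∀ t > T,
      1 / (c * t * (Real.log t) ^ 2) ≤ deriv (iterLog m) (2 * t + phiIter m n t) ∧
      deriv (iterLog m) (2 * t + phiIter m n t) ≤ c / (t * Real.log t)) := by
  refine ⟨tendsto_phiIter_div_log (by omega) hn, ?_, ?_, ?_⟩
  · obtain ⟨k, rfl⟩ := Nat.exists_eq_add_of_le' (show 1 ≤ m by omega)
    exact ⟨k + 1, by positivity,
      exists_pos_of_eventually_atTop (eventually_abs_deriv_phiIter_le hn)⟩
  · exact ⟨(m : ℝ) ^ 2, by positivity,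
      exists_pos_of_eventually_atTop (eventually_abs_deriv_deriv_phiIter_le m hn)⟩
  · obtain ⟨c, hc, h⟩ := exists_deriv_iterLog_two_mul_add_phiIter_bounds hm hn
    exact ⟨c, hc, exists_pos_of_eventually_atTop h⟩
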